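/- Let φ be a Jacob's ladder on [T₀,∞) with k₁T ≤ φ(T) ≤ k₂T for all T ≥ T₀ (for some constants 0 < k₁ ≤ k₂), satisfying ln(φ(T)/2) = ln T + O(1/ln T) as T → ∞, and assume the Balasubramanian formula: for every ε > 0, ∫₀^T Z(t)² dt = T ln T + (2c − 1 − ln 2π)T + O(T^{1/3+ε}) as T → ∞. Fix ε > 0 and set U₀ = T^{1/3+2ε}. Then as T → ∞, uniformly over all subintervals [N, M] ⊆ [T, T+U₀] with N < M whose chord of the curve y = φ(t)/2 is parallel to the chord over [T, T+U₀], i.e. [φ(M) − φ(N)]/(M − N) = [φ(T+U₀) − φ(T)]/U₀, one has ∫_N^M Z(t)² dt = (M−N)·ln N + (2c − ln 2π)·(M−N) + O((M−N)/ln T) + O(T^{−(1/3−4ε)}). -/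

import Mathlib

open Real MeasureTheory Filter

/-- `Z(t)²`, i.e. `|ζ(1/2 + it)|²`. -/
noncomputable def Z2 (t : ℝ) : ℝ := ‖riemannZeta (1/2 + Complex.I * t)‖ ^ 2

/-- The constant `a = ln(2π) − 1 − c`, where `c` is the Euler–Mascheroni constant. -/
noncomputable def aConst : ℝ := Real.log (2 * Real.pi) - 1 - Real.eulerMascheroniConstant

lemma continuous_Z2 : Continuous Z2 := by
  unfold Z2
  refine Continuous.pow (Continuous.norm ?_) 2
  rw [continuous_iff_continuousAt]
  intro t
  have hne : (1/2 + Complex.I * t : ℂ) ≠ 1 := by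
    intro h
    have := congrArg Complex.re h
    norm_num at this
  exact ContinuousAt.comp (f := fun t : ℝ => (1/2 + Complex.I * t : ℂ))
    (differentiableAt_riemannZeta hne).continuousAt
    (by fun_prop)

/-- First-order Taylor expansion of `x log x` with explicit quadratic remainder. -/
lemma mul_log_sub_bounds {x y : ℝ} (hx : 0 < x) (hxy : x ≤ y) :
    0 ≤ y * log y - x * log x - (y - x) * (log x + 1) ∧
      y * log y - x * log x - (y - x) * (log x + 1) ≤ (y - x) ^ 2 / x := by
  have hy : 0 < y := hx.trans_le hxy
  have e : y * log y - x * log x - (y - x) * (log x + 1) = y * log (y / x) - (y - x) := by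
    rw [log_div hy.ne' hx.ne']; ring
  rw [e]
  constructor
  · have h := one_sub_inv_le_log_of_pos (div_pos hy hx)
    have h2 := mul_le_mul_of_nonneg_left h hy.le
    have : y * (1 - (y / x)⁻¹) = y - x := by field_simp
    linarith
  · have h := log_le_sub_one_of_pos (div_pos hy hx)
    have h2 := mul_le_mul_of_nonneg_left h hy.le
    have : y * (y / x - 1) = (y - x) + (y - x) ^ 2 / x := by field_simp; ring
    linarith

/-- Increment of a function approximated by `x log x + b x + d` up to an error `δ`. -/
lemma increment_bounds {x y b d δ f g : ℝ} (hx : 0 < x) (hxy : x ≤ y)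
    (hf : |f - x * log x - b * x - d| ≤ δ) (hg : |g - y * log y - b * y - d| ≤ δ) :
    (y - x) * (log x + (1 + b)) - 2 * δ ≤ g - f ∧
      g - f ≤ (y - x) * (log x + (1 + b)) + (y - x) ^ 2 / x + 2 * δ := by
  obtain ⟨h1, h2⟩ := mul_log_sub_bounds hx hxy
  obtain ⟨h3, h4⟩ := abs_le.1 hf
  obtain ⟨h5, h6⟩ := abs_le.1 hg
  constructor <;> nlinarith

/-- A chord slope `s` satisfying two approximate equations is `1 + O(1 / L)`. -/
lemma slope_bounds {A B L a b s d w : ℝ} (ha : 0 ≤ a) (hb : 0 ≤ b) (hs : 0 ≤ s)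
    (hL1 : 1 ≤ L) (hL : 2 * (|A| + |B| + 2 * a) ≤ L)
    (hd : |d - (L + B)| ≤ a / L) (hw : |w - L| ≤ a / L)
    (hlow : s * (w + A) - a / L ≤ d)
    (hup : d ≤ s * (w + A) + s ^ 2 * (b / L) + a / L) :
    s ≤ 4 ∧ |s * (L + A) - (L + B)| ≤ (6 * a + 16 * b) / L := by
  have hL0 : 0 < L := by linarith
  have haL : a / L ≤ a := div_le_self ha hL1
  have haL0 : 0 ≤ a / L := by positivity
  have hbL0 : 0 ≤ b / L := by positivity
  obtain ⟨d1, d2⟩ := abs_le.1 hd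
  obtain ⟨w1, w2⟩ := abs_le.1 hw
  have A1 := neg_abs_le A
  have B1 := le_abs_self B
  have hA0 := abs_nonneg A
  have hB0 := abs_nonneg B
  have hwA : L / 2 ≤ w + A := by linarith
  have h1 : s * (L / 2) ≤ s * (w + A) := mul_le_mul_of_nonneg_left hwA hs
  have h2 : s * (L / 2) ≤ 2 * L := by linarith
  have hs4 : s ≤ 4 := by
    by_contra hcon
    push Not at hcon
    nlinarith
  refine ⟨hs4, ?_⟩
  have e : (6 * a + 16 * b) / L = 6 * (a / L) + 16 * (b / L) := by ring
  rw [e]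
  have hsa : s * (a / L) ≤ 4 * (a / L) := mul_le_mul_of_nonneg_right hs4 haL0
  have hsw1 : s * (w - L) ≤ s * (a / L) := mul_le_mul_of_nonneg_left w2 hs
  have hsw2 : s * (-(a / L)) ≤ s * (w - L) := mul_le_mul_of_nonneg_left w1 hs
  have hsb : s ^ 2 * (b / L) ≤ 16 * (b / L) :=
    mul_le_mul_of_nonneg_right (by nlinarith) hbL0
  rw [abs_le]
  constructor <;> linarith

/-- For a chord of slope `s = 1 + O(1 / L)`, replace the ladder by the main term. -/
lemma chord_bounds {A B L s a b e w n Δ D r : ℝ} (hb : 0 ≤ b)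
    (hs : 0 ≤ s) (hs4 : s ≤ 4) (hΔ : 0 ≤ Δ) (hL0 : 0 < L)
    (he : |s * (L + A) - (L + B)| ≤ e / L) (hw : |w - n| ≤ a / L)
    (hn : |n - L| ≤ 1 / L)
    (hlow : Δ * (s * (w + A)) - r ≤ D)
    (hup : D ≤ Δ * (s * (w + A)) + Δ * (s ^ 2 * (b / L)) + r) :
    |D - (Δ * n + B * Δ)| ≤ (e + 5 + 4 * a + 16 * b) * (Δ / L) + r := by
  have hbL0 : 0 ≤ b / L := by positivity
  have hsb : s ^ 2 * (b / L) ≤ 16 * (b / L) :=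
    mul_le_mul_of_nonneg_right (by nlinarith) hbL0
  have h1 : |s * (w - n)| ≤ 4 * (a / L) := by
    rw [abs_mul, abs_of_nonneg hs]
    exact mul_le_mul hs4 hw (abs_nonneg _) (by norm_num)
  have h2 : |(s - 1) * (n - L)| ≤ 5 * (1 / L) := by
    rw [abs_mul]
    exact mul_le_mul (abs_le.2 ⟨by linarith, by linarith⟩) hn (abs_nonneg _) (by norm_num)
  have key : |s * (w + A) - (n + B)| ≤ e / L + 4 * (a / L) + 5 * (1 / L) := by
    have : s * (w + A) - (n + B)
        = (s * (L + A) - (L + B)) + s * (w - n) + (s - 1) * (n - L) := by ring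
    rw [this]
    exact (abs_add_three _ _ _).trans (by linarith)
  obtain ⟨k1, k2⟩ := abs_le.1 key
  have k1' := mul_le_mul_of_nonneg_left k1 hΔ
  have k2' := mul_le_mul_of_nonneg_left k2 hΔ
  have hsb' := mul_le_mul_of_nonneg_left hsb hΔ
  have hb' : 0 ≤ Δ * (16 * (b / L)) := by positivity
  have e1 : (e + 5 + 4 * a + 16 * b) * (Δ / L)
      = Δ * (e / L + 4 * (a / L) + 5 * (1 / L)) + Δ * (16 * (b / L)) := by ring
  rw [e1, abs_le]
  constructor <;> nlinarith

/-- `log T` is eventually dominated by any positive power of `T`. -/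
lemma eventually_log_le_rpow {p : ℝ} (hp : 0 < p) : ∀ᶠ T : ℝ in atTop, log T ≤ T ^ p := by
  filter_upwards [(isLittleO_log_rpow_atTop hp).bound one_pos, eventually_ge_atTop 0] with T h h0
  rw [one_mul, norm_of_nonneg (rpow_nonneg h0 _)] at h
  exact (le_norm_self _).trans h

set_option maxHeartbeats 1000000 in
/-- Short-interval case: `U = T ^ (1/3 + 2ε)` is of smaller order than `T / log T`. -/
lemma parallel_chords_of_lt {φ F : ℝ → ℝ} {T₀ b β c₀ : ℝ}
    (hmono : StrictMonoOn φ (Set.Ici T₀))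
    (hladder : ∃ C : ℝ, ∀ T ≥ T₀,
      |F T - (φ T / 2) * log (φ T / 2) - b * (φ T / 2) - c₀| ≤ C * log T / T)
    {k : ℝ} (hk : 0 < k) (hgrowth : ∀ T ≥ T₀, k * T ≤ φ T)
    (hlog : ∃ C T₁ : ℝ, ∀ T ≥ T₁, |log (φ T / 2) - log T| ≤ C / log T)
    {ε : ℝ} (hε : 0 < ε) (hε' : ε < 1 / 3)
    (hBal : ∃ C T₁ : ℝ, ∀ T ≥ T₁, |F T - T * log T - β * T| ≤ C * T ^ ((1:ℝ)/3 + ε)) :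
    ∃ C T₁ : ℝ, ∀ T ≥ T₁, ∀ N M : ℝ, T ≤ N → N < M → M ≤ T + T ^ ((1:ℝ)/3 + 2*ε) →
      (φ M - φ N) / (M - N) = (φ (T + T ^ ((1:ℝ)/3 + 2*ε)) - φ T) / T ^ ((1:ℝ)/3 + 2*ε) →
      |(F M - F N) - ((M - N) * log N + (1 + β) * (M - N))|
        ≤ C * ((M - N) / log T + T ^ (-((1:ℝ)/3 - 4*ε))) := by
  obtain ⟨C₁, h1⟩ := hladder
  obtain ⟨C₂, T₂, h2⟩ := hlog
  obtain ⟨C₃, T₃, h3⟩ := hBal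
  obtain ⟨K, hK0, hK1, hK2, hK3⟩ : ∃ K : ℝ, 0 ≤ K ∧ C₁ ≤ K ∧ C₂ ≤ K ∧ C₃ ≤ K :=
    ⟨max 0 (max C₁ (max C₂ C₃)), by simp, by simp, by simp, by simp⟩
  have hL := tendsto_log_atTop.eventually_ge_atTop
    (1 + 2 * (|1 + b| + |1 + β| + 2 * (1 + 4 * K)))
  have ev : ∀ᶠ T : ℝ in atTop, T₀ ≤ T ∧ T₂ ≤ T ∧ T₃ ≤ T ∧ 2 ≤ T ∧
      1 + 2 * (|1 + b| + |1 + β| + 2 * (1 + 4 * K)) ≤ log T ∧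
      log T ≤ T ^ (2/3 - 2*ε) ∧ log T ≤ T ^ ε := by
    filter_upwards [eventually_ge_atTop T₀, eventually_ge_atTop T₂, eventually_ge_atTop T₃,
      eventually_ge_atTop 2, hL, eventually_log_le_rpow (p := 2/3 - 2*ε) (by linarith),
      eventually_log_le_rpow hε] with T a1 a2 a3 a4 a5 a6 a7
    exact ⟨a1, a2, a3, a4, a5, a6, a7⟩
  obtain ⟨T₁, hT₁⟩ := eventually_atTop.1 ev
  refine ⟨(6 * (1 + 4 * K) + 16 * (2 / k)) + 5 + 4 * (1 + 4 * K) + 16 * (2 / k) + 4 * K, T₁, ?_⟩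
  intro T hT N M hTN hNM hMU hchord
  obtain ⟨g0, g2, g3, gT2, gL, gA, gB⟩ := hT₁ T hT
  set U := T ^ ((1:ℝ)/3 + 2*ε) with hU
  set P := T ^ ((1:ℝ)/3 + ε) with hP
  set E := T ^ (-((1:ℝ)/3 - 4*ε)) with hE
  set L := log T with hLdef
  have hT0 : 0 < T := by linarith
  have hT1 : 1 ≤ T := by linarith
  have hU0 : 0 < U := rpow_pos_of_pos hT0 _
  have hE0 : 0 < E := rpow_pos_of_pos hT0 _
  have hP1 : 1 ≤ P := one_le_rpow hT1 (by linarith)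
  have hL1 : 1 ≤ L := by
    have := abs_nonneg (1 + b)
    have := abs_nonneg (1 + β)
    linarith
  have hL0 : 0 < L := by linarith
  have hUL : U * L ≤ T := by
    calc U * L ≤ U * T ^ (2/3 - 2*ε) := mul_le_mul_of_nonneg_left gA hU0.le
      _ = T ^ (1:ℝ) := by rw [hU, ← rpow_add hT0]; congr 1; ring
      _ = T := rpow_one T
  have hPL : P * L ≤ U := by
    calc P * L ≤ P * T ^ ε := mul_le_mul_of_nonneg_left gB (by linarith)
      _ = U := by rw [hP, hU, ← rpow_add hT0]; congr 1; ring
  have hLU : L ≤ U := (le_mul_of_one_le_left hL0.le hP1).trans hPL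
  have hUT : U ≤ T := (le_mul_of_one_le_right hU0.le hL1).trans hUL
  have hLE : L / T ≤ E := by
    rw [div_le_iff₀ hT0]
    calc L ≤ T ^ (2/3 - 2*ε) := gA
      _ ≤ T ^ (-((1:ℝ)/3 - 4*ε) + 1) := rpow_le_rpow_of_exponent_le hT1 (by linarith)
      _ = E * T := by rw [rpow_add hT0, rpow_one]
  have hUTL : U / T ≤ 1 / L := by
    rw [div_le_div_iff₀ hT0 hL0]; linarith
  have hLTU : L / T ≤ U * (1 / L) := by
    rw [mul_one_div, div_le_div_iff₀ hT0 hL0]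
    exact mul_le_mul hLU (hLU.trans hUT) hL0.le hU0.le
  -- bounds at any point of the interval
  have pt : ∀ x, T ≤ x → x ≤ T + U →
      |F x - (φ x / 2) * log (φ x / 2) - b * (φ x / 2) - c₀| ≤ 2 * K * (L / T) ∧
      |F x - x * log x - β * x - 0| ≤ 2 * K * P ∧
      |log (φ x / 2) - log x| ≤ K / L ∧ |log x - L| ≤ 1 / L ∧ k * T / 2 ≤ φ x / 2 := by
    intro x hx hxU
    have hx0 : 0 < x := by linarith
    have hx2 : x ≤ 2 * T := by linarith
    have hLx : L ≤ log x := log_le_log hT0 hx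
    have hlx : log x ≤ 2 * L := by
      have : log x ≤ log (T * T) := log_le_log hx0 (hx2.trans (mul_le_mul_of_nonneg_right gT2 hT0.le))
      rw [log_mul hT0.ne' hT0.ne'] at this
      linarith
    have hlx0 : 0 < log x := by linarith
    refine ⟨(h1 x (by linarith)).trans ?_, ?_, (h2 x (by linarith)).trans ?_, ?_, ?_⟩
    · calc C₁ * log x / x = C₁ * (log x / x) := by ring
        _ ≤ K * (log x / x) := mul_le_mul_of_nonneg_right hK1 (by positivity)
        _ ≤ K * (2 * L / T) := by gcongr
        _ = 2 * K * (L / T) := by ring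
    · rw [sub_zero]
      refine (h3 x (by linarith)).trans ?_
      have hxp : x ^ ((1:ℝ)/3 + ε) ≤ 2 * P := by
        calc x ^ ((1:ℝ)/3 + ε) ≤ (2 * T) ^ ((1:ℝ)/3 + ε) :=
              rpow_le_rpow hx0.le hx2 (by linarith)
          _ = 2 ^ ((1:ℝ)/3 + ε) * P := mul_rpow (by norm_num) hT0.le
          _ ≤ 2 ^ (1:ℝ) * P := by
              gcongr
              · norm_num
              · linarith
          _ = 2 * P := by rw [rpow_one]
      exact (mul_le_mul hK3 hxp (rpow_nonneg hx0.le _) hK0).trans (by linarith)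
    · calc C₂ / log x ≤ K / log x := by gcongr
        _ ≤ K / L := by gcongr
    · rw [abs_of_nonneg (by linarith), hLdef, ← log_div hx0.ne' hT0.ne']
      have e : x / T - 1 = (x - T) / T := by field_simp
      calc log (x / T) ≤ x / T - 1 := log_le_sub_one_of_pos (by positivity)
        _ = (x - T) / T := e
        _ ≤ U / T := by gcongr; linarith
        _ ≤ 1 / L := hUTL
    · have := hgrowth x (by linarith)
      have : k * T ≤ k * x := by gcongr
      linarith
  have hkT : 0 < k * T / 2 := by positivity
  -- ladder increments
  have inc : ∀ x y, T ≤ x → x ≤ y → y ≤ T + U → ∀ s, (φ y - φ x) / 2 = s * (y - x) →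
      (y - x) * (s * (log (φ x / 2) + (1 + b))) - 4 * K * (L / T) ≤ F y - F x ∧
      F y - F x ≤ (y - x) * (s * (log (φ x / 2) + (1 + b)))
        + (y - x) * (s ^ 2 * ((2 / k) / L)) + 4 * K * (L / T) := by
    intro x y hx hxy hy s hs
    obtain ⟨p1, -, -, -, p5⟩ := pt x hx (hxy.trans hy)
    obtain ⟨q1, -⟩ := pt y (hx.trans hxy) hy
    have hφ : φ x / 2 ≤ φ y / 2 := by
      have : φ x ≤ φ y := hmono.monotoneOn (Set.mem_Ici.2 (by linarith))
        (Set.mem_Ici.2 (by linarith)) hxy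
      linarith
    obtain ⟨i1, i2⟩ := increment_bounds (hkT.trans_le p5) hφ p1 q1
    have e : φ y / 2 - φ x / 2 = s * (y - x) := by linarith
    rw [e] at i1 i2
    have hrem : (s * (y - x)) ^ 2 / (φ x / 2) ≤ (y - x) * (s ^ 2 * ((2 / k) / L)) := by
      calc (s * (y - x)) ^ 2 / (φ x / 2) ≤ (s * (y - x)) ^ 2 / (k * T / 2) := by gcongr
        _ = (y - x) * (s ^ 2 * ((2 / k) * ((y - x) / T))) := by field_simp
        _ ≤ (y - x) * (s ^ 2 * ((2 / k) * (1 / L))) := by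
            have : (y - x) / T ≤ 1 / L := by
              refine le_trans ?_ hUTL
              gcongr
              linarith
            have hyx : 0 ≤ y - x := by linarith
            gcongr
        _ = _ := by ring
    constructor <;> linarith
  set s := (φ (T + U) - φ T) / U / 2 with hs
  have hs0 : 0 ≤ s := by
    have : φ T ≤ φ (T + U) := hmono.monotoneOn (Set.mem_Ici.2 g0)
      (Set.mem_Ici.2 (by linarith)) (by linarith)
    have : 0 ≤ φ (T + U) - φ T := by linarith
    positivity
  obtain ⟨-, p2, p3, -, -⟩ := pt T le_rfl (by linarith)
  obtain ⟨-, q2, -⟩ := pt (T + U) (by linarith) le_rfl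
  obtain ⟨a1, a2⟩ := increment_bounds hT0 (by linarith) p2 q2
  obtain ⟨l1, l2⟩ := inc T (T + U) le_rfl (by linarith) le_rfl s (by rw [hs]; field_simp; ring)
  rw [add_sub_cancel_left] at a1 a2 l1 l2
  set D := F (T + U) - F T with hD
  have hDU : D = U * (D / U) := by field_simp
  have hPU : P ≤ U * (1 / L) := by
    rw [mul_one_div, le_div_iff₀ hL0]; exact hPL
  have hU2 : U ^ 2 / T ≤ U * (1 / L) := by
    calc U ^ 2 / T = U * (U / T) := by ring
      _ ≤ _ := mul_le_mul_of_nonneg_left hUTL hU0.le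
  have hKP := mul_le_mul_of_nonneg_left hPU hK0
  have hKLT := mul_le_mul_of_nonneg_left hLTU hK0
  have ea : (1 + 4 * K) / L = 1 / L + 4 * (K * (1 / L)) := by ring
  have hL10 : 0 ≤ 1 / L := by positivity
  have hKL10 : 0 ≤ K * (1 / L) := by positivity
  have hUL10 : 0 ≤ U * (1 / L) := by positivity
  obtain ⟨hs4, hslope⟩ := slope_bounds (A := 1 + b) (B := 1 + β) (L := L) (a := 1 + 4 * K)
    (b := 2 / k) (s := s) (d := D / U) (w := log (φ T / 2)) (by positivity) (by positivity) hs0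
    hL1 (by linarith)
    (by
      have hUT2 : 0 ≤ U ^ 2 / T := by positivity
      rw [ea, abs_le]
      constructor
      · refine le_of_mul_le_mul_left ?_ hU0
        rw [mul_sub, ← hDU]
        linarith
      · refine le_of_mul_le_mul_left ?_ hU0
        rw [mul_sub, ← hDU]
        linarith)
    (p3.trans (by rw [ea, div_eq_mul_one_div K L]; linarith))
    (by
      rw [ea]
      refine le_of_mul_le_mul_left ?_ hU0
      rw [← hDU]
      linarith)
    (by
      rw [ea]
      refine le_of_mul_le_mul_left ?_ hU0
      rw [← hDU]
      linarith)
  obtain ⟨-, -, n3, n4, -⟩ := pt N hTN (by linarith)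
  have hMN : 0 < M - N := by linarith
  obtain ⟨m1, m2⟩ := inc N M hTN hNM.le hMU s (by rw [hs, ← hchord]; field_simp)
  have fin := chord_bounds (by positivity) hs0 hs4 hMN.le hL0 hslope
    (n3.trans (by rw [ea, div_eq_mul_one_div K L]; linarith)) n4 m1 m2
  refine fin.trans ?_
  have hq : 0 ≤ (M - N) / L := by positivity
  have hKE := mul_le_mul_of_nonneg_left hLE hK0
  have hk2 : 0 ≤ 2 / k := by positivity
  have z1 : 0 ≤ K * ((M - N) / L) := by positivity
  have z2 : 0 ≤ K * E := by positivity
  have z3 : 0 ≤ 2 / k * E := by positivity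
  clear_value U P E L D s
  linarith

/-- Long-interval case: the mean-value formula alone suffices. -/
lemma increment_bound_of_ge {F : ℝ → ℝ} {β ε : ℝ} (hε : 1 / 3 ≤ ε)
    (hBal : ∃ C T₁ : ℝ, ∀ T ≥ T₁, |F T - T * log T - β * T| ≤ C * T) :
    ∃ C T₁ : ℝ, ∀ T ≥ T₁, ∀ N M : ℝ, T ≤ N → N < M → M ≤ T + T ^ ((1:ℝ)/3 + 2*ε) →
      |(F M - F N) - ((M - N) * log N + (1 + β) * (M - N))|
        ≤ C * ((M - N) / log T + T ^ (-((1:ℝ)/3 - 4*ε))) := by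
  obtain ⟨C, T₁, h⟩ := hBal
  refine ⟨1 + 4 * |C|, max 1 T₁, ?_⟩
  intro T hT N M hTN hNM hMU
  have hT1 : 1 ≤ T := le_of_max_le_left hT
  have hT2 : T₁ ≤ T := le_of_max_le_right hT
  have hT0 : 0 < T := by linarith
  set U := T ^ ((1:ℝ)/3 + 2*ε) with hU
  set E := T ^ (-((1:ℝ)/3 - 4*ε)) with hE
  have hUE : U ≤ E := rpow_le_rpow_of_exponent_le hT1 (by linarith)
  have hTU : T ≤ U := by
    calc T = T ^ (1:ℝ) := (rpow_one T).symm
      _ ≤ U := rpow_le_rpow_of_exponent_le hT1 (by linarith)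
  have hEU : U ^ 2 / T = E := by
    rw [div_eq_iff hT0.ne', hU, hE, ← rpow_natCast, ← rpow_mul hT0.le]
    nth_rw 3 [← rpow_one T]
    rw [← rpow_add hT0]
    congr 1
    push_cast
    ring
  have hδ : ∀ x, T ≤ x → x ≤ M → |F x - x * log x - β * x - 0| ≤ |C| * (2 * E) := by
    intro x hx hxM
    rw [sub_zero]
    refine (h x (by linarith)).trans ?_
    exact mul_le_mul (le_abs_self C) (by linarith) (by linarith) (abs_nonneg C)
  obtain ⟨i1, i2⟩ := increment_bounds (by linarith) hNM.le (hδ N hTN hNM.le)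
    (hδ M (by linarith) le_rfl)
  have hrem : (M - N) ^ 2 / N ≤ E := by
    rw [← hEU]
    have : 0 ≤ M - N := by linarith
    gcongr
    linarith
  have hq : 0 ≤ (M - N) / log T := div_nonneg (by linarith) (log_nonneg hT1)
  have hCq : 0 ≤ |C| * ((M - N) / log T) := by positivity
  rw [abs_le]
  constructor <;> nlinarith [abs_nonneg C]

theorem parallel_chords_formula
    (φ : ℝ → ℝ) (T₀ : ℝ)
    (hcont : ContinuousOn φ (Set.Ici T₀))
    (hmono : StrictMonoOn φ (Set.Ici T₀))
    (hpos : ∀ T ≥ T₀, 0 < φ T)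
    (hladder : ∃ c₀ C : ℝ, ∀ T ≥ T₀,
      |(∫ t in (0:ℝ)..T, Z2 t) - (φ T / 2) * Real.log (φ T / 2)
        - (Real.eulerMascheroniConstant - Real.log (2 * Real.pi)) * (φ T / 2) - c₀|
        ≤ C * Real.log T / T)
    (k₁ k₂ : ℝ) (hk₁ : 0 < k₁) (hk₁₂ : k₁ ≤ k₂)
    (hgrowth : ∀ T ≥ T₀, k₁ * T ≤ φ T ∧ φ T ≤ k₂ * T)
    (hlog : ∃ C T₁ : ℝ, ∀ T ≥ T₁,
      |Real.log (φ T / 2) - Real.log T| ≤ C / Real.log T)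
    (hBal : ∀ ε > (0:ℝ), ∃ C T₁ : ℝ, ∀ T ≥ T₁,
      |(∫ t in (0:ℝ)..T, Z2 t) - T * Real.log T
        - (2 * Real.eulerMascheroniConstant - 1 - Real.log (2 * Real.pi)) * T|
        ≤ C * T ^ ((1:ℝ)/3 + ε))
    (ε : ℝ) (hε : 0 < ε) :
    ∃ C T₁ : ℝ, ∀ T ≥ T₁, ∀ N M : ℝ, T ≤ N → N < M → M ≤ T + T ^ ((1:ℝ)/3 + 2*ε) →
      (φ M - φ N) / (M - N) = (φ (T + T ^ ((1:ℝ)/3 + 2*ε)) - φ T) / T ^ ((1:ℝ)/3 + 2*ε) →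
      |(∫ t in N..M, Z2 t)
        - ((M - N) * Real.log N
          + (2 * Real.eulerMascheroniConstant - Real.log (2 * Real.pi)) * (M - N))|
        ≤ C * ((M - N) / Real.log T + T ^ (-((1:ℝ)/3 - 4*ε))) := by
  have hint : ∀ x y : ℝ, IntervalIntegrable Z2 volume x y :=
    fun x y => continuous_Z2.intervalIntegrable x y
  have hsub : ∀ N M : ℝ, (∫ t in N..M, Z2 t)
      = (∫ t in (0:ℝ)..M, Z2 t) - (∫ t in (0:ℝ)..N, Z2 t) := fun N M =>
    (intervalIntegral.integral_interval_sub_left (hint 0 M) (hint 0 N)).symm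
  have hB : 2 * Real.eulerMascheroniConstant - Real.log (2 * Real.pi)
      = 1 + (2 * Real.eulerMascheroniConstant - 1 - Real.log (2 * Real.pi)) := by ring
  rcases lt_or_ge ε (1 / 3) with hε' | hε'
  · obtain ⟨c₀, hladder⟩ := hladder
    obtain ⟨C, T₁, h⟩ := parallel_chords_of_lt (F := fun T => ∫ t in (0:ℝ)..T, Z2 t) hmono
      hladder hk₁ (fun T hT => (hgrowth T hT).1) hlog hε hε' (hBal ε hε)
    refine ⟨C, T₁, fun T hT N M hTN hNM hMU hchord => ?_⟩
    rw [hsub, hB]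
    exact h T hT N M hTN hNM hMU hchord
  · obtain ⟨C₂, T₂, h₂⟩ := hBal (2 / 3) (by norm_num)
    obtain ⟨C, T₁, h⟩ := increment_bound_of_ge (F := fun T => ∫ t in (0:ℝ)..T, Z2 t) hε'
      ⟨C₂, T₂, fun T hT => by
        have e : ((1:ℝ) / 3 + 2 / 3) = 1 := by norm_num
        simpa only [e, rpow_one] using h₂ T hT⟩
    refine ⟨C, T₁, fun T hT N M hTN hNM hMU _ => ?_⟩
    rw [hsub, hB]
    exact h T hT N M hTN hNM hMU
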